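/- Let π : 2^ℕ → [0,1] be the standard continuous order-preserving surjection identifying the endpoints of jumps (e.g. the binary expansion map x ↦ Σ xₙ 2^{-(n+1)}). Then C ↦ π(C) is a bijection from the set of nowhere dense copies of 2^ℕ inside 2^ℕ to the set of copies of 2^ℕ inside [0,1], with inverse mapping C to the Cantor–Bendixson derivative (set of non-isolated points) of π^{-1}(C). -/

import Mathlib

/-- The binary expansion map from the Cantor space to `[0,1]`, identifying endpoints of jumps. -/
noncomputable def binExp (x : ℕ → Bool) : ℝ :=
  ∑' n : ℕ, (if x n then (1 : ℝ) else 0) / 2 ^ (n + 1)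

/-- The Cantor–Bendixson derivative of a set: its non-isolated points. -/
def cbDeriv {α : Type*} [TopologicalSpace α] (S : Set α) : Set α :=
  {x ∈ S | AccPt x (Filter.principal S)}

section

open Set Filter Topology

/-- Some clopen set cuts `A` into two nonempty parts if `A` is open and nonempty, and equals `U`
whenever `U` cuts `A` into two nonempty parts. -/
theorem exists_isClopen_split {X : Type*} [TopologicalSpace X] [CompactSpace X] [T2Space X]
    [TotallyDisconnectedSpace X] [PerfectSpace X] {U : Set X} (hU : IsClopen U) (A : Set X) :
    ∃ S : Set X, IsClopen S ∧ (IsOpen A → A.Nonempty → (A ∩ S).Nonempty ∧ (A \ S).Nonempty) ∧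
      ((A ∩ U).Nonempty → (A \ U).Nonempty → S = U) := by
  by_cases h : (A ∩ U).Nonempty ∧ (A \ U).Nonempty
  · exact ⟨U, hU, fun _ _ => h, fun _ _ => rfl⟩
  by_cases hA : IsOpen A ∧ A.Nonempty
  · obtain ⟨hA, x, hx⟩ := hA
    obtain ⟨y, ⟨-, hyA⟩, hyx⟩ := preperfect_iff_nhds.1 hA.preperfect x hx univ univ_mem
    obtain ⟨S, hS, hxS, hyS⟩ := exists_isClopen_of_totally_separated hyx.symm
    exact ⟨S, hS, fun _ _ => ⟨⟨x, hx, hxS⟩, ⟨y, hyA, hyS⟩⟩, fun h₁ h₂ => absurd ⟨h₁, h₂⟩ h⟩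
  · exact ⟨univ, isClopen_univ, fun h₁ h₂ => absurd ⟨h₁, h₂⟩ hA, fun h₁ h₂ => absurd ⟨h₁, h₂⟩ h⟩

open Classical in
/-- The piece containing `x` after `n` steps of splitting according to the rule `S`. -/
noncomputable def splitCell {X : Type*} (S : ℕ → Set X → Set X) : ℕ → X → Set X
  | 0, _ => univ
  | n + 1, x => if x ∈ S n (splitCell S n x) then splitCell S n x ∩ S n (splitCell S n x)
      else splitCell S n x \ S n (splitCell S n x)

open Classical in
/-- The sequence of choices made along the pieces containing `x`. -/
noncomputable def splitCode {X : Type*} (S : ℕ → Set X → Set X) (x : X) (n : ℕ) : Bool :=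
  decide (x ∈ S n (splitCell S n x))

theorem mem_splitCell {X : Type*} (S : ℕ → Set X → Set X) (n : ℕ) (x : X) :
    x ∈ splitCell S n x := by
  induction n with
  | zero => trivial
  | succ n ih => by_cases h : x ∈ S n (splitCell S n x) <;> simp [splitCell, h, ih]

theorem isClopen_splitCell {X : Type*} [TopologicalSpace X] {S : ℕ → Set X → Set X}
    (hS : ∀ n A, IsClopen (S n A)) (n : ℕ) (x : X) : IsClopen (splitCell S n x) := by
  induction n with
  | zero => exact isClopen_univ
  | succ n ih =>
    rw [splitCell]
    split_ifs
    · exact ih.inter (hS _ _)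
    · exact ih.diff (hS _ _)

theorem mem_splitCell_iff {X : Type*} {S : ℕ → Set X → Set X} {n : ℕ} {x y : X} :
    y ∈ splitCell S n x ↔ ∀ i < n, splitCode S y i = splitCode S x i := by
  suffices h : (y ∈ splitCell S n x ↔ ∀ i < n, splitCode S y i = splitCode S x i) ∧
      (y ∈ splitCell S n x → splitCell S n y = splitCell S n x) from h.1
  induction n with
  | zero => simp [splitCell]
  | succ n ih =>
    have key : y ∈ splitCell S (n + 1) x ↔
        y ∈ splitCell S n x ∧ splitCode S y n = splitCode S x n := by
      by_cases hy : y ∈ splitCell S n x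
      · have := ih.2 hy
        by_cases h : x ∈ S n (splitCell S n x) <;> simp [splitCell, splitCode, h, hy, this]
      · by_cases h : x ∈ S n (splitCell S n x) <;> simp [splitCell, h, hy]
    refine ⟨?_, fun h => ?_⟩
    · rw [key, ih.1, Nat.forall_lt_succ_right]
    · obtain ⟨h₁, h₂⟩ := key.1 h
      have h₃ := ih.2 h₁
      simp only [splitCode, h₃, decide_eq_decide] at h₂
      have h₄ : y ∈ S n (splitCell S n y) ↔ x ∈ S n (splitCell S n x) := h₃ ▸ h₂
      by_cases hx : x ∈ S n (splitCell S n x)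
      · rw [splitCell, splitCell, if_pos hx, if_pos (h₄.2 hx), h₃]
      · rw [splitCell, splitCell, if_neg hx, if_neg (h₄.not.2 hx), h₃]

theorem splitCell_eq {X : Type*} {S : ℕ → Set X → Set X} {n : ℕ} {x y : X}
    (h : y ∈ splitCell S n x) : splitCell S n y = splitCell S n x := by
  ext z
  rw [mem_splitCell_iff] at *
  rw [mem_splitCell_iff]
  exact forall₂_congr fun i hi => by rw [h i hi]

/-- **Brouwer characterization of the Cantor space**: a nonempty, perfect, compact, Hausdorff,
second countable, totally disconnected space is homeomorphic to the Cantor space. -/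
theorem nonempty_homeomorph_nat_bool (X : Type*) [TopologicalSpace X] [CompactSpace X] [T2Space X]
    [TotallyDisconnectedSpace X] [PerfectSpace X] [SecondCountableTopology X] [Nonempty X] :
    Nonempty (X ≃ₜ (ℕ → Bool)) := by
  have : Countable (TopologicalSpace.Clopens X) :=
    TopologicalSpace.Clopens.countable_iff_secondCountable.2 inferInstance
  obtain ⟨U, hU⟩ := exists_surjective_nat (TopologicalSpace.Clopens X)
  choose S hS hsplit hsep using fun (n : ℕ) => exists_isClopen_split (U n).isClopen
  have hcont : Continuous (splitCode S) := by
    refine continuous_pi fun n => IsLocallyConstant.continuous ?_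
    refine (IsLocallyConstant.iff_eventually_eq _).2 fun x => ?_
    filter_upwards [(isClopen_splitCell hS (n + 1) x).isOpen.mem_nhds (mem_splitCell S _ x)]
      with y hy
    exact mem_splitCell_iff.1 hy n n.lt_succ_self
  have hinj : Function.Injective (splitCode S) := by
    intro x y hxy
    by_contra hne
    obtain ⟨V, hV, hxV, hyV⟩ := exists_isClopen_of_totally_separated hne
    obtain ⟨n, hn⟩ := hU ⟨V, hV⟩
    have hV' : (U n : Set X) = V := by rw [hn]; rfl
    have hmem : y ∈ splitCell S n x := mem_splitCell_iff.2 fun i _ => by rw [hxy]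
    have hSV := hsep n (splitCell S n x) ⟨x, mem_splitCell S n x, hV' ▸ hxV⟩
      ⟨y, hmem, hV' ▸ hyV⟩
    have := congrFun hxy n
    simp only [splitCode, splitCell_eq hmem, hSV, hV', decide_eq_decide] at this
    exact hyV (this.1 hxV)
  have hprefix : ∀ (b : ℕ → Bool) (n : ℕ), ∃ x, ∀ i < n, splitCode S x i = b i := by
    intro b n
    induction n with
    | zero => simp
    | succ n ih =>
      obtain ⟨x, hx⟩ := ih
      obtain ⟨⟨y, hy, hyS⟩, ⟨z, hz, hzS⟩⟩ := hsplit n (splitCell S n x)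
        (isClopen_splitCell hS n x).isOpen ⟨x, mem_splitCell S n x⟩
      simp only [Nat.forall_lt_succ_right]
      cases hb : b n
      · refine ⟨z, fun i hi => (mem_splitCell_iff.1 hz i hi).trans (hx i hi), ?_⟩
        simpa [splitCode, splitCell_eq hz] using hzS
      · refine ⟨y, fun i hi => (mem_splitCell_iff.1 hy i hi).trans (hx i hi), ?_⟩
        simpa [splitCode, splitCell_eq hy] using hyS
  have hsurj : Function.Surjective (splitCode S) := by
    intro b
    choose u hu using hprefix b
    have hlim : Tendsto (fun n => splitCode S (u n)) atTop (𝓝 b) :=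
      tendsto_pi_nhds.2 fun i => tendsto_const_nhds.congr' <| by
        filter_upwards [eventually_gt_atTop i] with n hn using (hu n i hn).symm
    exact (isCompact_range hcont).isClosed.mem_of_tendsto hlim
      (Eventually.of_forall fun n => mem_range_self _)
  exact ⟨hcont.homeoOfEquivCompactToT2 (f := Equiv.ofBijective _ ⟨hinj, hsurj⟩)⟩

theorem accPt_principal_subtype {X : Type*} [TopologicalSpace X] {S : Set X} (x : S) :
    AccPt (x : X) (𝓟 S) ↔ (𝓝[≠] x).NeBot := by
  rw [accPt_principal_iff_nhdsWithin, ← mem_closure_iff_nhdsWithin_neBot,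
    ← mem_closure_iff_nhdsWithin_neBot, closure_subtype]
  congr! 2
  ext y
  simp only [Set.mem_sdiff, mem_singleton_iff, mem_image, mem_compl_iff, Subtype.exists,
    exists_and_right, exists_eq_right, Subtype.ext_iff]
  exact exists_prop.symm

theorem perfectSpace_subtype_iff {X : Type*} [TopologicalSpace X] {S : Set X} :
    PerfectSpace S ↔ Preperfect S := by
  rw [perfectSpace_iff_forall_not_isolated]
  simp only [← accPt_principal_subtype, Subtype.forall]
  rfl

instance : PerfectSpace (ℕ → Bool) := by
  refine perfectSpace_iff_forall_not_isolated.2 fun x => ?_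
  have hlim : Tendsto (fun n => Function.update x n (!x n)) atTop (𝓝 x) :=
    tendsto_pi_nhds.2 fun i => tendsto_const_nhds.congr' <| by
      filter_upwards [eventually_ne_atTop i] with n hn using by simp [hn.symm]
  have hne : ∀ n, Function.update x n (!x n) ≠ x := fun n h => by simpa using congrFun h n
  exact (tendsto_nhdsWithin_of_tendsto_nhds_of_eventually_within _ hlim
    (Eventually.of_forall hne)).neBot

theorem Homeomorph.perfectSpace {X Y : Type*} [TopologicalSpace X] [TopologicalSpace Y]
    [PerfectSpace Y] (e : X ≃ₜ Y) : PerfectSpace X := by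
  refine perfectSpace_iff_forall_not_isolated.2 fun x => ?_
  have h := PerfectSpace.not_isolated (e x)
  rwa [← e.map_punctured_nhds_eq, map_neBot_iff] at h

theorem binExp_eq_fromBinary (x : ℕ → Bool) : binExp x = Real.fromBinary x := by
  simp only [binExp, Real.fromBinary, Real.ofDigits, Real.ofDigitsTerm, Subtype.coind,
    Function.comp, Homeomorph.piCongrRight]
  have : ∀ b, finTwoEquiv.toHomeomorphOfDiscrete.symm b = finTwoEquiv.symm b := fun _ => rfl
  refine tsum_congr fun n => ?_
  cases h : x n <;> simp [h, this] <;> rfl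

theorem continuous_binExp : Continuous binExp := by
  simp_rw [funext binExp_eq_fromBinary]
  exact continuous_subtype_val.comp Real.fromBinary_continuous

theorem binExp_mem_Icc (x : ℕ → Bool) : binExp x ∈ Icc (0 : ℝ) 1 :=
  binExp_eq_fromBinary x ▸ (Real.fromBinary x).2

theorem exists_binExp_eq {t : ℝ} (ht : t ∈ Icc (0 : ℝ) 1) : ∃ x, binExp x = t := by
  obtain ⟨x, hx⟩ := Real.fromBinary_surjective ⟨t, ht⟩
  exact ⟨x, by rw [binExp_eq_fromBinary, hx]⟩

theorem binExp_eq_shift (x : ℕ → Bool) :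
    binExp x = ((if x 0 then 1 else 0) + binExp fun n => x (n + 1)) / 2 := by
  have hs : Summable fun n : ℕ => (if x n then (1 : ℝ) else 0) / 2 ^ (n + 1) := by
    refine Summable.of_nonneg_of_le (fun n => by positivity) (fun n => ?_)
      (summable_geometric_two.mul_left (1 / 2))
    rw [← pow_succ', one_div_pow]
    gcongr
    split_ifs <;> norm_num
  rw [binExp, hs.tsum_eq_zero_add, binExp, add_div, ← tsum_div_const]
  simp [pow_succ, div_div]

theorem eq_false_of_binExp_eq_zero {x : ℕ → Bool} (hx : binExp x = 0) (n : ℕ) : x n = false := by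
  induction n generalizing x with
  | zero =>
    have := (binExp_mem_Icc fun n => x (n + 1)).1
    rw [binExp_eq_shift] at hx
    cases h : x 0
    · rfl
    · simp only [h, if_true] at hx
      linarith
  | succ n ih =>
    have := (binExp_mem_Icc fun n => x (n + 1)).1
    rw [binExp_eq_shift] at hx
    refine ih (x := fun n => x (n + 1)) ?_
    cases h : x 0 <;> simp only [h, if_true, Bool.false_eq_true, if_false] at hx <;> linarith

theorem eq_true_of_binExp_eq_one {x : ℕ → Bool} (hx : binExp x = 1) (n : ℕ) : x n = true := by
  induction n generalizing x with
  | zero =>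
    have := (binExp_mem_Icc fun n => x (n + 1)).2
    rw [binExp_eq_shift] at hx
    cases h : x 0
    · simp only [h, Bool.false_eq_true, if_false] at hx
      linarith
    · rfl
  | succ n ih =>
    have := (binExp_mem_Icc fun n => x (n + 1)).2
    rw [binExp_eq_shift] at hx
    refine ih (x := fun n => x (n + 1)) ?_
    cases h : x 0 <;> simp only [h, if_true, Bool.false_eq_true, if_false] at hx <;> linarith

/-- Two binary expansions of the same number that differ before position `n` are constant
from position `n` on. -/
theorem eq_or_eventually_const_of_binExp_eq {x y : ℕ → Bool} (h : binExp x = binExp y) (n : ℕ) :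
    (∀ i < n, x i = y i) ∨ ∃ b, ∀ i, n ≤ i → x i = b := by
  induction n generalizing x y with
  | zero => simp
  | succ n ih =>
    have hx := binExp_mem_Icc fun n => x (n + 1)
    have hy := binExp_mem_Icc fun n => y (n + 1)
    rw [binExp_eq_shift x, binExp_eq_shift y] at h
    have hshift : ∀ b, (∀ i, x (i + 1) = b) → ∃ b, ∀ i, n + 1 ≤ i → x i = b := fun b hb =>
      ⟨b, fun i hi => by obtain ⟨j, rfl⟩ := Nat.exists_eq_add_of_le' (by omega : 1 ≤ i); exact hb j⟩
    by_cases h0 : x 0 = y 0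
    · rw [h0] at h
      rcases ih (x := fun n => x (n + 1)) (y := fun n => y (n + 1)) (by linarith) with h' | ⟨b, hb⟩
      · exact .inl fun i hi => by
          cases i with
          | zero => exact h0
          | succ i => exact h' i (by omega)
      · refine .inr ⟨b, fun i hi => ?_⟩
        obtain ⟨j, rfl⟩ := Nat.exists_eq_add_of_le' (by omega : 1 ≤ i)
        exact hb j (by omega)
    · refine .inr ?_
      cases hx0 : x 0
      · have hy0 : y 0 = true := by simpa [hx0] using h0
        simp only [hx0, hy0, if_true, Bool.false_eq_true, if_false] at h
        exact hshift true (eq_true_of_binExp_eq_one (by linarith [hx.2, hy.1]))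
      · have hy0 : y 0 = false := by simpa [hx0] using h0
        simp only [hx0, hy0, if_true, Bool.false_eq_true, if_false] at h
        exact hshift false (eq_false_of_binExp_eq_zero (by linarith [hx.1, hy.2]))

theorem exists_cylinder_subset {x : ℕ → Bool} {U : Set (ℕ → Bool)} (hU : U ∈ 𝓝 x) :
    ∃ n, PiNat.cylinder x n ⊆ U := by
  obtain ⟨_, ⟨y, n, rfl⟩, hx, h⟩ :=
    (PiNat.isTopologicalBasis_cylinders fun _ : ℕ => Bool).mem_nhds_iff.1 hU
  exact ⟨n, by rwa [PiNat.mem_cylinder_iff_eq.1 hx]⟩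

/-- Near `e`, except possibly at `e` itself, whole fibers of `binExp` are close to `e`. -/
theorem eventually_binExp_fiber_subset (e : ℕ → Bool) {U : Set (ℕ → Bool)} (hU : U ∈ 𝓝 e) :
    ∀ᶠ x in 𝓝[≠] e, ∀ y, binExp y = binExp x → y ∈ U := by
  obtain ⟨n, hn⟩ := exists_cylinder_subset hU
  have hfin : (range fun b : Bool => fun i => if i < n then e i else b).Finite := finite_range _
  have hcyl : PiNat.cylinder e n ∈ 𝓝[≠] e := mem_nhdsWithin_of_mem_nhds <|
    (PiNat.isOpen_cylinder _ e n).mem_nhds (PiNat.self_mem_cylinder e n)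
  have hbad : ∀ᶠ x in 𝓝[≠] e, x ∉ (range fun b : Bool => fun i => if i < n then e i else b) \ {e} :=
    mem_nhdsWithin_of_mem_nhds <| (hfin.subset sdiff_subset).isClosed.isOpen_compl.mem_nhds (by simp)
  filter_upwards [hcyl, hbad, self_mem_nhdsWithin] with x hx hxb hxe y hy
  rcases eq_or_eventually_const_of_binExp_eq hy.symm n with h | ⟨b, hb⟩
  · exact hn fun i hi => (h i hi).symm.trans (hx i hi)
  · refine absurd ⟨⟨b, funext fun i => ?_⟩, hxe⟩ hxb
    dsimp only
    split_ifs with hi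
    · exact (hx i hi).symm
    · exact (hb i (not_lt.1 hi)).symm

/-- The image of a cylinder contains a nondegenerate interval. -/
theorem exists_Icc_subset_binExp_image_cylinder (x : ℕ → Bool) (n : ℕ) :
    ∃ a b, a < b ∧ Icc a b ⊆ binExp '' PiNat.cylinder x n := by
  induction n generalizing x with
  | zero =>
    refine ⟨0, 1, zero_lt_one, fun t ht => ?_⟩
    simpa using exists_binExp_eq ht
  | succ n ih =>
    obtain ⟨a, b, hab, h⟩ := ih fun i => x (i + 1)
    set c : ℝ := if x 0 then 1 else 0
    refine ⟨(c + a) / 2, (c + b) / 2, by linarith, fun t ht => ?_⟩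
    obtain ⟨y, hy, hyt⟩ := @h (2 * t - c) ⟨by linarith [ht.1], by linarith [ht.2]⟩
    refine ⟨fun i => Nat.casesOn i (x 0) y, fun i hi => ?_, ?_⟩
    · cases i with
      | zero => rfl
      | succ i => exact hy i (by omega)
    · rw [binExp_eq_shift]
      change (c + binExp y) / 2 = t
      rw [hyt]
      ring

theorem nonempty_homeomorph_nat_bool_iff {X : Type*} [TopologicalSpace X] [T2Space X]
    [SecondCountableTopology X] {S : Set X} :
    Nonempty (S ≃ₜ (ℕ → Bool)) ↔
      IsCompact S ∧ Preperfect S ∧ IsTotallyDisconnected S ∧ S.Nonempty := by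
  constructor
  · rintro ⟨e⟩
    have := e.symm.compactSpace
    have := e.perfectSpace
    exact ⟨isCompact_iff_compactSpace.2 inferInstance, perfectSpace_subtype_iff.1 inferInstance,
      totallyDisconnectedSpace_subtype_iff.1
        (e.symm.totallyDisconnectedSpace), ⟨_, (e.symm fun _ => true).2⟩⟩
  · rintro ⟨hc, hp, ht, hn⟩
    have := isCompact_iff_compactSpace.1 hc
    have := perfectSpace_subtype_iff.2 hp
    have := totallyDisconnectedSpace_subtype_iff.2 ht
    have := hn.to_subtype
    exact nonempty_homeomorph_nat_bool S

theorem accPt_principal_iff_frequently_punctured {X : Type*} [TopologicalSpace X] {x : X}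
    {S : Set X} : AccPt x (𝓟 S) ↔ ∃ᶠ y in 𝓝[≠] x, y ∈ S :=
  frequently_mem_iff_neBot.symm

theorem IsClosed.cbDeriv_eq_derivedSet {X : Type*} [TopologicalSpace X] {S : Set X}
    (hS : IsClosed S) : cbDeriv S = derivedSet S :=
  inter_eq_right.2 (isClosed_iff_derivedSet_subset S |>.1 hS)

theorem eventually_binExp_ne (e : ℕ → Bool) : ∀ᶠ x in 𝓝[≠] e, binExp x ≠ binExp e := by
  by_contra h
  have h' : ∃ᶠ x in 𝓝[≠] e, binExp x = binExp e :=
    (not_eventually.1 h).mono fun _ => not_not.1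
  obtain ⟨z, hz, hze⟩ := (h'.and_eventually self_mem_nhdsWithin).exists
  obtain ⟨x, hx, hxU⟩ := (h'.and_eventually
    (eventually_binExp_fiber_subset e (isOpen_ne.mem_nhds (Ne.symm hze)))).exists
  exact hxU z (hz.trans hx.symm) rfl

/-- A point outside a closed set `C` is not an accumulation point of the saturation of `C`. -/
theorem eventually_notMem_preimage_image_binExp {C : Set (ℕ → Bool)} (hC : IsClosed C)
    {e : ℕ → Bool} (he : e ∉ C) : ∀ᶠ x in 𝓝[≠] e, x ∉ binExp ⁻¹' (binExp '' C) := by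
  filter_upwards [eventually_binExp_fiber_subset e (hC.isOpen_compl.mem_nhds he)]
  rintro x hx ⟨y, hy, hyx⟩
  exact hx y hyx hy

theorem cbDeriv_preimage_image_binExp {C : Set (ℕ → Bool)} (hC : IsClosed C)
    (hp : Preperfect C) : cbDeriv (binExp ⁻¹' (binExp '' C)) = C := by
  refine Subset.antisymm (fun x hx => ?_) fun x hx =>
    ⟨subset_preimage_image _ _ hx, (hp x hx).mono (principal_mono.2 (subset_preimage_image _ _))⟩
  by_contra hxC
  exact accPt_principal_iff_frequently_punctured.1 hx.2
    (eventually_notMem_preimage_image_binExp hC hxC)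

theorem tendsto_binExp_punctured (x : ℕ → Bool) :
    Tendsto binExp (𝓝[≠] x) (𝓝[≠] (binExp x)) :=
  tendsto_nhdsWithin_of_tendsto_nhds_of_eventually_within _
    (continuous_binExp.continuousAt.mono_left nhdsWithin_le_nhds) (eventually_binExp_ne x)

theorem Preperfect.image_binExp {C : Set (ℕ → Bool)} (hp : Preperfect C) :
    Preperfect (binExp '' C) := by
  rintro _ ⟨x, hx, rfl⟩
  rw [accPt_principal_iff_frequently_punctured]
  exact (tendsto_binExp_punctured x).frequently
    ((accPt_principal_iff_frequently_punctured.1 (hp x hx)).mono fun y => mem_image_of_mem _)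

theorem isTotallyDisconnected_image_binExp {C : Set (ℕ → Bool)} (hC : IsClosed C)
    (hd : IsNowhereDense C) : IsTotallyDisconnected (binExp '' C) := by
  intro T hTC hT
  by_contra hsub
  obtain ⟨a, ha, b, hb, hab⟩ := (not_subsingleton_iff.1 hsub).exists_lt
  have hIcc : Icc a b ⊆ binExp '' C := (hT.Icc_subset ha hb).trans hTC
  have hW : IsOpen (binExp ⁻¹' Ioo a b) := isOpen_Ioo.preimage continuous_binExp
  have hWC : binExp ⁻¹' Ioo a b ⊆ C := by
    intro w hw
    by_contra hwC
    obtain ⟨x, hx, hxw⟩ := ((eventually_notMem_preimage_image_binExp hC hwC).and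
      (mem_nhdsWithin_of_mem_nhds (hW.mem_nhds hw))).exists
    exact hx (hIcc (Ioo_subset_Icc_self hxw))
  obtain ⟨c, hc⟩ := exists_between hab
  obtain ⟨w, -, rfl⟩ := hIcc (Ioo_subset_Icc_self hc)
  have : w ∈ interior C := interior_maximal hWC hW hc
  rw [hC.isNowhereDense_iff.1 hd] at this
  exact this

theorem image_cbDeriv_preimage_binExp {D : Set ℝ} (hD : D ⊆ Icc 0 1) (hp : Preperfect D) :
    binExp '' cbDeriv (binExp ⁻¹' D) = D := by
  refine Subset.antisymm (image_subset_iff.2 fun x hx => hx.1) fun d hd => ?_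
  have hF : (comap binExp (𝓝[≠] d ⊓ 𝓟 D)).NeBot := by
    have : (𝓝[≠] d ⊓ 𝓟 D).NeBot := hp d hd
    refine comap_neBot_iff_frequently.2 (Eventually.frequently ?_)
    filter_upwards [mem_inf_of_right (mem_principal_self D)] with t ht using exists_binExp_eq (hD ht)
  obtain ⟨p, hp⟩ := exists_clusterPt_of_compactSpace (comap binExp (𝓝[≠] d ⊓ 𝓟 D))
  have hpd : binExp p = d := by
    have := hp.map continuous_binExp.continuousAt tendsto_comap
    exact eq_of_nhds_neBot (this.mono (inf_le_left.trans nhdsWithin_le_nhds))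
  refine ⟨p, ⟨by rwa [mem_preimage, hpd], ?_⟩, hpd⟩
  rw [accPt_iff_clusterPt]
  refine hp.mono (le_inf ?_ ?_)
  · rw [le_principal_iff]
    filter_upwards [preimage_mem_comap (mem_inf_of_left self_mem_nhdsWithin)] with x hx hxp
    exact hx (by rw [mem_singleton_iff.1 hxp, hpd]; rfl)
  · exact le_principal_iff.2 (preimage_mem_comap (mem_inf_of_right (mem_principal_self D)))

theorem preperfect_cbDeriv_preimage_binExp {D : Set ℝ} (hD : D ⊆ Icc 0 1) (hp : Preperfect D) :
    Preperfect (cbDeriv (binExp ⁻¹' D)) := by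
  intro p hpD
  rw [accPt_iff_nhds]
  intro U hU
  obtain ⟨x, hxD, hxp, hxU⟩ := ((accPt_principal_iff_frequently_punctured.1 hpD.2).and_eventually
    ((eventually_binExp_ne p).and (eventually_binExp_fiber_subset p hU))).exists
  obtain ⟨q, hq, hqx⟩ := (image_cbDeriv_preimage_binExp hD hp).ge hxD
  exact ⟨q, ⟨hxU q hqx, hq⟩, fun h => hxp (by rw [← hqx, h])⟩

theorem isNowhereDense_preimage_binExp {D : Set ℝ} (hD : IsClosed D)
    (ht : IsTotallyDisconnected D) : IsNowhereDense (binExp ⁻¹' D) := by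
  rw [(hD.preimage continuous_binExp).isNowhereDense_iff, eq_empty_iff_forall_notMem]
  intro x hx
  obtain ⟨n, hn⟩ := exists_cylinder_subset (mem_interior_iff_mem_nhds.1 hx)
  obtain ⟨a, b, hab, h⟩ := exists_Icc_subset_binExp_image_cylinder x n
  exact hab.ne (ht (Icc a b) (h.trans (image_subset_iff.2 hn)) isPreconnected_Icc
    (left_mem_Icc.2 hab.le) (right_mem_Icc.2 hab.le))

end

/-- `C ↦ binExp '' C` is a bijection from the nowhere dense copies of the Cantor space inside
the Cantor space to the copies of the Cantor space inside `[0,1]`, with inverse sending `D` to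
the Cantor–Bendixson derivative of `binExp ⁻¹' D`. -/
theorem binExp_image_bijection_on_nowhere_dense_cantor_copies :
    (∀ C : Set (ℕ → Bool), Nonempty (C ≃ₜ (ℕ → Bool)) → IsNowhereDense C →
      Nonempty ((binExp '' C : Set ℝ) ≃ₜ (ℕ → Bool)) ∧
      binExp '' C ⊆ Set.Icc (0 : ℝ) 1 ∧
      cbDeriv (binExp ⁻¹' (binExp '' C)) = C) ∧
    (∀ D : Set ℝ, D ⊆ Set.Icc (0 : ℝ) 1 → Nonempty (D ≃ₜ (ℕ → Bool)) →
      Nonempty ((cbDeriv (binExp ⁻¹' D) : Set (ℕ → Bool)) ≃ₜ (ℕ → Bool)) ∧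
      IsNowhereDense (cbDeriv (binExp ⁻¹' D)) ∧
      binExp '' cbDeriv (binExp ⁻¹' D) = D) := by
  constructor
  · intro C hC hd
    obtain ⟨hc, hp, -, hn⟩ := nonempty_homeomorph_nat_bool_iff.1 hC
    refine ⟨nonempty_homeomorph_nat_bool_iff.2 ⟨hc.image continuous_binExp, hp.image_binExp,
      isTotallyDisconnected_image_binExp hc.isClosed hd, hn.image _⟩,
      Set.image_subset_iff.2 fun x _ => binExp_mem_Icc x,
      cbDeriv_preimage_image_binExp hc.isClosed hp⟩
  · intro D hD hDC
    obtain ⟨hc, hp, ht, hn⟩ := nonempty_homeomorph_nat_bool_iff.1 hDC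
    have himage := image_cbDeriv_preimage_binExp hD hp
    have hclosed : IsClosed (cbDeriv (binExp ⁻¹' D)) := by
      rw [(hc.isClosed.preimage continuous_binExp).cbDeriv_eq_derivedSet]
      exact isClosed_derivedSet _
    exact ⟨nonempty_homeomorph_nat_bool_iff.2 ⟨hclosed.isCompact,
      preperfect_cbDeriv_preimage_binExp hD hp, isTotallyDisconnected_of_totallyDisconnectedSpace _,
      Set.image_nonempty.1 (himage.symm ▸ hn)⟩,
      (isNowhereDense_preimage_binExp hc.isClosed ht).mono fun x hx => hx.1, himage⟩
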